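/- Let V be a convex origin-symmetric body in ℝ^n and V° its polar body. Then Vol_n(V) ≤ E[‖·‖_{V°}]^n · Vol_n(B₂ⁿ), where E[‖·‖_{V°}] is the mean of the norm with unit ball V° over the uniform probability measure on S^{n−1}. -/

import Mathlib

open MeasureTheory

open scoped Pointwise in
theorem bm1 {s t : ℝ} (hs : 0 < s) (ht : 0 < t) {A B C : Set ℝ} (hA : MeasurableSet A)
    (hB : MeasurableSet B) (hAn : A.Nonempty) (hBn : B.Nonempty)
    (h : ∀ x ∈ A, ∀ y ∈ B, s * x + t * y ∈ C) :
    ENNReal.ofReal s * volume A + ENNReal.ofReal t * volume B ≤ volume C := by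
  have key : ∀ K L : Set ℝ, IsCompact K → IsCompact L → K.Nonempty → L.Nonempty → K ⊆ A → L ⊆ B →
      ENNReal.ofReal s * volume K + ENNReal.ofReal t * volume L ≤ volume C := by
    intro K L hK hL hKn hLn hKA hLB
    obtain ⟨a, haK, ha⟩ := hK.exists_isGreatest hKn
    obtain ⟨b, hbL, hb⟩ := hL.exists_isLeast hLn
    set K' : Set ℝ := (fun x => s * x + t * b) '' K
    set L' : Set ℝ := (fun x => s * a + t * x) '' L
    have hK' : volume K' = ENNReal.ofReal s * volume K := by
      have : K' = (fun x => x + t * b) '' (s • K) := by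
        rw [← Set.image_smul, Set.image_image]; rfl
      rw [this]
      rw [Set.image_add_right, measure_preimage_add_right, Measure.addHaar_smul]
      simp [abs_of_pos hs]
    have hL' : volume L' = ENNReal.ofReal t * volume L := by
      have : L' = (fun x => s * a + x) '' (t • L) := by
        rw [← Set.image_smul, Set.image_image]; rfl
      rw [this]
      rw [Set.image_add_left, measure_preimage_add, Measure.addHaar_smul]
      simp [abs_of_pos ht]
    have hLc : IsCompact L' := hL.image (by fun_prop)
    rw [← hK', ← hL', ← measure_union_add_inter _ hLc.measurableSet]
    have hint : volume (K' ∩ L') = 0 := by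
      refine measure_mono_null (t := {s * a + t * b}) ?_ (by simp)
      rintro z ⟨⟨x, hx, rfl⟩, ⟨y, hy, hxy⟩⟩
      have h1 := ha hx
      have h2 := hb hy
      simp only [Set.mem_singleton_iff] at *
      nlinarith
    rw [hint, add_zero]
    apply measure_mono
    rintro z (⟨x, hx, rfl⟩ | ⟨x, hx, rfl⟩)
    · exact h _ (hKA hx) _ (hLB hbL)
    · exact h _ (hKA haK) _ (hLB hx)
  obtain ⟨a0, ha0⟩ := hAn
  obtain ⟨b0, hb0⟩ := hBn
  have key2 : ∀ K L : Set ℝ, IsCompact K → IsCompact L → K ⊆ A → L ⊆ B →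
      ENNReal.ofReal s * volume K + ENNReal.ofReal t * volume L ≤ volume C := by
    intro K L hK hL hKA hLB
    refine le_trans ?_ (key (insert a0 K) (insert b0 L) (hK.insert _) (hL.insert _) (by simp)
      (by simp) (Set.insert_subset ha0 hKA) (Set.insert_subset hb0 hLB))
    gcongr <;> simp
  have hsup : ∀ S : Set ℝ, MeasurableSet S →
      volume S = ⨆ (K : Set ℝ) (_ : K ⊆ S ∧ IsCompact K), volume K := by
    intro S hS
    rw [hS.measure_eq_iSup_isCompact]
    simp only [iSup_and]
  rw [hsup A hA, hsup B hB]
  simp only [ENNReal.mul_iSup]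
  exact ENNReal.biSup_add_biSup_le' ⟨∅, by simp⟩ ⟨∅, by simp⟩
    fun K hK L hL => key2 K L hK.2 hL.2 hK.1 hL.1

theorem layer {φ : ℝ → ENNReal} (hφ : Measurable φ) (h1 : ∀ x, φ x ≤ 1) :
    ∫⁻ x, φ x = ∫⁻ τ in Set.Ioi (0 : ℝ), volume {x | ENNReal.ofReal τ < φ x} := by
  have hfin : ∀ x, φ x ≠ ⊤ := fun x => ((h1 x).trans_lt ENNReal.one_lt_top).ne
  have := lintegral_eq_lintegral_meas_lt (f := fun x => (φ x).toReal) (volume : Measure ℝ)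
    (Filter.Eventually.of_forall fun x => ENNReal.toReal_nonneg) hφ.ennreal_toReal.aemeasurable
  simp only [ENNReal.ofReal_toReal (hfin _)] at this
  rw [this]
  refine setLIntegral_congr_fun measurableSet_Ioi fun τ hτ => ?_
  congr 1
  ext x
  exact (ENNReal.ofReal_lt_iff_lt_toReal (le_of_lt hτ) (hfin x)).symm

theorem pl1n {s t : ℝ} (hs : 0 < s) (ht : 0 < t) (hst : s + t = 1) {f g h : ℝ → ENNReal}
    (hf : Measurable f) (hg : Measurable g) (hh : Measurable h)
    (hf1 : ⨆ x, f x = 1) (hg1 : ⨆ x, g x = 1)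
    (H : ∀ x y, f x ^ s * g y ^ t ≤ h (s * x + t * y)) :
    ENNReal.ofReal s * (∫⁻ x, f x) + ENNReal.ofReal t * (∫⁻ x, g x) ≤ ∫⁻ x, h x := by
  have hk : ∫⁻ x, min (h x) 1 ≤ ∫⁻ x, h x := lintegral_mono fun x => min_le_left _ _
  refine le_trans ?_ hk
  rw [layer hf (fun x => hf1 ▸ le_iSup f x), layer hg (fun x => hg1 ▸ le_iSup g x),
    layer (hh.min measurable_const) (fun x => min_le_right _ _),
    ← lintegral_const_mul' _ _ ENNReal.ofReal_ne_top,
    ← lintegral_const_mul' _ _ ENNReal.ofReal_ne_top]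
  refine (le_lintegral_add _ _).trans (setLIntegral_mono' measurableSet_Ioi fun τ hτ => ?_)
  have hτ : 0 < τ := hτ
  by_cases h1 : ENNReal.ofReal τ < 1
  · apply bm1 hs ht (measurableSet_lt measurable_const hf) (measurableSet_lt measurable_const hg)
    · rw [← hf1] at h1
      exact lt_iSup_iff.1 h1
    · rw [← hg1] at h1
      exact lt_iSup_iff.1 h1
    · intro x hx y hy
      simp only [Set.mem_ofPred_eq] at *
      refine lt_min (lt_of_lt_of_le ?_ (H x y)) h1
      have e : ENNReal.ofReal τ = ENNReal.ofReal τ ^ s * ENNReal.ofReal τ ^ t := by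
        rw [← ENNReal.rpow_add _ _ (by simpa using hτ) ENNReal.ofReal_ne_top, hst, ENNReal.rpow_one]
      rw [e]
      exact ENNReal.mul_lt_mul (ENNReal.rpow_lt_rpow hx hs) (ENNReal.rpow_lt_rpow hy ht)
  · have h1 : 1 ≤ ENNReal.ofReal τ := not_lt.1 h1
    have e1 : {x | ENNReal.ofReal τ < f x} = ∅ := by
      ext x; simpa using (hf1 ▸ le_iSup f x).trans h1
    have e2 : {x | ENNReal.ofReal τ < g x} = ∅ := by
      ext x; simpa using (hg1 ▸ le_iSup g x).trans h1
    simp [e1, e2]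

theorem amgm {s t : ℝ} (hs : 0 < s) (ht : 0 < t) (hst : s + t = 1) (a b : ENNReal) :
    a ^ s * b ^ t ≤ ENNReal.ofReal s * a + ENNReal.ofReal t * b := by
  have hc : (s⁻¹).HolderConjugate t⁻¹ := by
    rw [Real.holderConjugate_iff]
    refine ⟨(one_lt_inv₀ hs).2 (by linarith), by simpa using hst⟩
  have := ENNReal.young_inequality (a ^ s) (b ^ t) hc
  rw [← ENNReal.rpow_mul, ← ENNReal.rpow_mul, mul_inv_cancel₀ hs.ne', mul_inv_cancel₀ ht.ne',
    ENNReal.rpow_one, ENNReal.rpow_one, ENNReal.ofReal_inv_of_pos hs, ENNReal.ofReal_inv_of_pos ht,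
    div_eq_mul_inv, div_eq_mul_inv, inv_inv, inv_inv] at this
  rwa [mul_comm (ENNReal.ofReal s), mul_comm (ENNReal.ofReal t)]

theorem pl1b {s t : ℝ} (hs : 0 < s) (ht : 0 < t) (hst : s + t = 1) {f g h : ℝ → ENNReal}
    (hf : Measurable f) (hg : Measurable g) (hh : Measurable h)
    (hf1 : ⨆ x, f x ≠ ⊤) (hg1 : ⨆ x, g x ≠ ⊤)
    (H : ∀ x y, f x ^ s * g y ^ t ≤ h (s * x + t * y)) :
    (∫⁻ x, f x) ^ s * (∫⁻ x, g x) ^ t ≤ ∫⁻ x, h x := by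
  set a := ⨆ x, f x with ha
  set b := ⨆ x, g x with hb
  by_cases ha0 : a = 0
  · have : ∀ x, f x = 0 := fun x => le_antisymm (ha0 ▸ le_iSup f x) bot_le
    simp [this, hs]
  by_cases hb0 : b = 0
  · have : ∀ x, g x = 0 := fun x => le_antisymm (hb0 ▸ le_iSup g x) bot_le
    simp [this, ht]
  have has : a ^ s ≠ ⊤ := ENNReal.rpow_ne_top_of_nonneg hs.le hf1
  have hbt : b ^ t ≠ ⊤ := ENNReal.rpow_ne_top_of_nonneg ht.le hg1
  have has0 : a ^ s ≠ 0 := by simp [ha0, hf1]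
  have hbt0 : b ^ t ≠ 0 := by simp [hb0, hg1]
  have h1 := pl1n hs ht hst (f := fun x => a⁻¹ * f x) (g := fun x => b⁻¹ * g x)
    (h := fun x => (a ^ s * b ^ t)⁻¹ * h x) (hf.const_mul _) (hg.const_mul _) (hh.const_mul _)
    (by rw [← ENNReal.mul_iSup, ← ha, ENNReal.inv_mul_cancel ha0 hf1])
    (by rw [← ENNReal.mul_iSup, ← hb, ENNReal.inv_mul_cancel hb0 hg1])
    (by
      intro x y
      rw [ENNReal.mul_rpow_of_nonneg _ _ hs.le, ENNReal.mul_rpow_of_nonneg _ _ ht.le,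
        ENNReal.inv_rpow, ENNReal.inv_rpow, ENNReal.mul_inv (Or.inl has0) (Or.inl has),
        mul_mul_mul_comm]
      gcongr
      exact H x y)
  have h2 := (amgm hs ht hst _ _).trans h1
  rw [lintegral_const_mul _ hf, lintegral_const_mul _ hg, lintegral_const_mul _ hh,
    ENNReal.mul_rpow_of_nonneg _ _ hs.le, ENNReal.mul_rpow_of_nonneg _ _ ht.le,
        ENNReal.inv_rpow, ENNReal.inv_rpow, mul_mul_mul_comm,
        ← ENNReal.mul_inv (Or.inl has0) (Or.inl has)] at h2
  exact (ENNReal.mul_le_mul_iff_right (ENNReal.inv_ne_zero.2 (ENNReal.mul_ne_top has hbt))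
    (ENNReal.inv_ne_top.2 (mul_ne_zero has0 hbt0))).1 h2

theorem trunc {f : ℝ → ENNReal} (hf : Measurable f) :
    ∫⁻ x, f x = ⨆ M : ℕ, ∫⁻ x, min (f x) M := by
  rw [← lintegral_iSup (fun M => hf.min measurable_const)
    (fun M N h x => min_le_min le_rfl (by exact_mod_cast h))]
  congr with x
  rw [← inf_iSup_eq, ENNReal.iSup_natCast, inf_top_eq]

theorem pl1 {s t : ℝ} (hs : 0 < s) (ht : 0 < t) (hst : s + t = 1) {f g h : ℝ → ENNReal}
    (hf : Measurable f) (hg : Measurable g) (hh : Measurable h)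
    (H : ∀ x y, f x ^ s * g y ^ t ≤ h (s * x + t * y)) :
    (∫⁻ x, f x) ^ s * (∫⁻ x, g x) ^ t ≤ ∫⁻ x, h x := by
  have r : ∀ {s : ℝ} (hs : 0 < s) (u : ℕ → ENNReal), (⨆ M, u M) ^ s = ⨆ M, u M ^ s :=
    fun {s} hs u => (ENNReal.orderIsoRpow s hs).map_iSup u
  rw [trunc hf, trunc hg, r hs, r ht]
  simp only [ENNReal.iSup_mul, ENNReal.mul_iSup]
  refine iSup_le fun N => iSup_le fun M => ?_
  refine pl1b hs ht hst (hf.min measurable_const) (hg.min measurable_const) hh ?_ ?_ ?_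
  · exact ((iSup_le fun x => min_le_right _ _).trans_lt (ENNReal.natCast_lt_top M)).ne
  · exact ((iSup_le fun x => min_le_right _ _).trans_lt (ENNReal.natCast_lt_top N)).ne
  · intro x y
    refine le_trans ?_ (H x y)
    gcongr <;> exact min_le_left _ _

theorem pln {s t : ℝ} (hs : 0 < s) (ht : 0 < t) (hst : s + t = 1) (n : ℕ) :
    ∀ {f g h : (Fin n → ℝ) → ENNReal}, Measurable f → Measurable g → Measurable h →
    (∀ x y, f x ^ s * g y ^ t ≤ h (s • x + t • y)) →
    (∫⁻ x, f x) ^ s * (∫⁻ x, g x) ^ t ≤ ∫⁻ x, h x := by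
  induction n with
  | zero =>
    intro f g h hf hg hh H
    rw [Measure.volume_pi_eq_dirac 0, lintegral_dirac, lintegral_dirac, lintegral_dirac]
    simpa using H 0 0
  | succ n ih =>
    intro f g h hf hg hh H
    set e := (MeasurableEquiv.piFinSuccAbove (fun _ : Fin (n + 1) => ℝ) 0).symm with he
    have hv : MeasurePreserving e :=
      (volume_preserving_piFinSuccAbove (fun _ : Fin (n + 1) => ℝ) 0).symm
    have key : ∀ {k : (Fin (n + 1) → ℝ) → ENNReal}, Measurable k →
        ∫⁻ x, k x = ∫⁻ a, ∫⁻ v, k (e (a, v)) := by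
      intro k hk
      rw [← hv.lintegral_comp hk, Measure.volume_eq_prod,
        lintegral_prod (fun a => k (e a)) (hk.comp e.measurable).aemeasurable]
    have hm : ∀ {k : (Fin (n + 1) → ℝ) → ENNReal}, Measurable k →
        Measurable fun a => ∫⁻ v, k (e (a, v)) := fun hk =>
      (hk.comp e.measurable).lintegral_prod_right'
    rw [key hf, key hg, key hh]
    refine pl1 hs ht hst (hm hf) (hm hg) (hm hh) fun a b => ?_
    refine ih (by fun_prop) (by fun_prop) (by fun_prop) fun x y => ?_
    refine (H _ _).trans (le_of_eq ?_)
    congr 1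
    ext i
    refine Fin.cases ?_ (fun j => ?_) i <;> simp [he, MeasurableEquiv.piFinSuccAbove]

theorem bme {s t : ℝ} (hs : 0 < s) (ht : 0 < t) (hst : s + t = 1) (n : ℕ)
    {A B C : Set (EuclideanSpace ℝ (Fin n))} (hA : MeasurableSet A) (hB : MeasurableSet B)
    (hC : MeasurableSet C) (h : ∀ x ∈ A, ∀ y ∈ B, s • x + t • y ∈ C) :
    volume A ^ s * volume B ^ t ≤ volume C := by
  classical
  have hv := PiLp.volume_preserving_toLp (Fin n)
  have key : ∀ {A : Set (EuclideanSpace ℝ (Fin n))}, MeasurableSet A →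
      Measurable (fun x : Fin n → ℝ => A.indicator (1 : EuclideanSpace ℝ (Fin n) → ENNReal) (WithLp.toLp 2 x)) ∧
      volume A = ∫⁻ x : Fin n → ℝ, A.indicator (1 : EuclideanSpace ℝ (Fin n) → ENNReal) (WithLp.toLp 2 x) := by
    intro A hA
    have hm : Measurable (A.indicator (1 : EuclideanSpace ℝ (Fin n) → ENNReal)) := measurable_one.indicator hA
    refine ⟨hm.comp hv.measurable, ?_⟩
    rw [hv.lintegral_comp hm, lintegral_indicator_one hA]
  rw [(key hA).2, (key hB).2, (key hC).2]
  refine pln hs ht hst n (key hA).1 (key hB).1 (key hC).1 fun x y => ?_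
  by_cases hx : WithLp.toLp 2 x ∈ A
  · by_cases hy : WithLp.toLp 2 y ∈ B
    · have := h _ hx _ hy
      simp [hx, hy, this]
    · simp [hy, ht]
  · simp [hx, hs]

theorem star_vol (n : ℕ) (hn : 0 < n)
    (ρ : Metric.sphere (0 : EuclideanSpace ℝ (Fin n)) 1 → ℝ) (hρ : Continuous ρ)
    (hpos : ∀ θ, 0 < ρ θ) :
    MeasurableSet ((Subtype.val : ({0}ᶜ : Set (EuclideanSpace ℝ (Fin n))) → _) ''
      (homeomorphUnitSphereProd (EuclideanSpace ℝ (Fin n)) ⁻¹' {p | (p.2 : ℝ) < ρ p.1})) ∧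
    volume ((Subtype.val : ({0}ᶜ : Set (EuclideanSpace ℝ (Fin n))) → _) ''
      (homeomorphUnitSphereProd (EuclideanSpace ℝ (Fin n)) ⁻¹' {p | (p.2 : ℝ) < ρ p.1})) =
    ∫⁻ θ, ENNReal.ofReal (ρ θ ^ n / n)
      ∂(volume : Measure (EuclideanSpace ℝ (Fin n))).toSphere := by
  have hD : IsOpen {p : Metric.sphere (0 : EuclideanSpace ℝ (Fin n)) 1 × Set.Ioi (0 : ℝ) |
      (p.2 : ℝ) < ρ p.1} := isOpen_lt (by fun_prop) (by fun_prop)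
  have hD' := hD.preimage (homeomorphUnitSphereProd (EuclideanSpace ℝ (Fin n))).continuous
  have h0 : MeasurableSet ({0}ᶜ : Set (EuclideanSpace ℝ (Fin n))) :=
    (measurableSet_singleton _).compl
  refine ⟨h0.subtype_image hD'.measurableSet, ?_⟩
  rw [← comap_subtype_coe_apply h0,
    (volume : Measure (EuclideanSpace ℝ (Fin n))).measurePreserving_homeomorphUnitSphereProd.measure_preimage
      hD.measurableSet.nullMeasurableSet, Measure.prod_apply hD.measurableSet]
  refine lintegral_congr fun θ => ?_
  have : Prod.mk θ ⁻¹' {p : Metric.sphere (0 : EuclideanSpace ℝ (Fin n)) 1 × Set.Ioi (0 : ℝ) |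
      (p.2 : ℝ) < ρ p.1} = Set.Iio (⟨ρ θ, hpos θ⟩ : Set.Ioi (0 : ℝ)) := by
    ext x; simp [← Subtype.coe_lt_coe]
  rw [this, Measure.volumeIoiPow_apply_Iio]
  obtain ⟨m, rfl⟩ : ∃ m, n = m + 1 := ⟨n - 1, by omega⟩
  simp

/-- The body `(1-t) B + t r⁻¹ V` lies inside the star body with radial function
`1 - t + t r⁻¹ gauge P`. -/
theorem first_step (n : ℕ) (hn : 0 < n) (V : Set (EuclideanSpace ℝ (Fin n)))
    (hVcpt : IsCompact V)
    (G : EuclideanSpace ℝ (Fin n) → ℝ) (hG : Continuous G) (hG0 : ∀ x, 0 ≤ G x)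
    (hGV : ∀ x ∈ V, ∀ θ, inner ℝ x θ ≤ G θ) {r : ℝ} (hr : 0 < r)
    (hvol : volume V = ENNReal.ofReal (r ^ n) *
      volume (Metric.ball (0 : EuclideanSpace ℝ (Fin n)) 1))
    {t : ℝ} (ht : 0 < t) (ht1 : t < 1) :
    volume (Metric.ball (0 : EuclideanSpace ℝ (Fin n)) 1) ≤
      ∫⁻ θ, ENNReal.ofReal ((1 + t * (G (θ : EuclideanSpace ℝ (Fin n)) / r - 1)) ^ n / n)
      ∂(volume : Measure (EuclideanSpace ℝ (Fin n))).toSphere := by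
  have : Nonempty (Fin n) := ⟨⟨0, hn⟩⟩
  set B := Metric.ball (0 : EuclideanSpace ℝ (Fin n)) 1 with hB
  have hpos : ∀ x, 0 < 1 + t * (G x / r - 1) := by
    intro x
    have : 0 ≤ t * (G x / r) := mul_nonneg ht.le (div_nonneg (hG0 x) hr.le)
    nlinarith
  obtain ⟨hm, hv⟩ := star_vol n hn
    (fun θ => 1 + t * (G (θ : EuclideanSpace ℝ (Fin n)) / r - 1)) (by fun_prop)
    (fun θ => hpos _)
  rw [← hv]
  set C := ((Subtype.val : ({0}ᶜ : Set (EuclideanSpace ℝ (Fin n))) → _) ''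
      (homeomorphUnitSphereProd (EuclideanSpace ℝ (Fin n)) ⁻¹'
        {p | (p.2 : ℝ) < 1 + t * (G (p.1 : EuclideanSpace ℝ (Fin n)) / r - 1)})) with hC
  have hK : volume ((fun x : EuclideanSpace ℝ (Fin n) => r⁻¹ • x) '' V) = volume B := by
    rw [Set.image_smul, Measure.addHaar_smul, hvol, ← mul_assoc,
      ← ENNReal.ofReal_mul (abs_nonneg _), finrank_euclideanSpace_fin, abs_of_pos (by positivity),
      ← mul_pow, inv_mul_cancel₀ hr.ne']
    simp
  have hbm := bme (s := 1 - t) (t := t) (by linarith) ht (by ring) n (A := B)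
    (B := (fun x : EuclideanSpace ℝ (Fin n) => r⁻¹ • x) '' V) (C := insert 0 C)
    Metric.isOpen_ball.measurableSet (hVcpt.image (by fun_prop)).measurableSet (hm.insert 0) (by
      rintro x hx _ ⟨v, hv, rfl⟩
      set z := (1 - t) • x + t • r⁻¹ • v with hz
      by_cases hz0 : z = 0
      · exact Or.inl hz0
      refine Or.inr ⟨⟨z, hz0⟩, ?_, rfl⟩
      have hzn : 0 < ‖z‖ := norm_pos_iff.2 hz0
      simp only [Set.mem_preimage, Set.mem_ofPred_eq, homeomorphUnitSphereProd_apply_fst_coe,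
        homeomorphUnitSphereProd_apply_snd_coe]
      set θ := ‖z‖⁻¹ • z with hθ
      have hθ1 : ‖θ‖ = 1 := by rw [hθ, norm_smul, norm_inv, norm_norm, inv_mul_cancel₀ hzn.ne']
      have e1 : ‖z‖ = inner ℝ z θ := by
        rw [hθ, inner_smul_right, real_inner_self_eq_norm_sq]
        field_simp
      have e2 : inner ℝ x θ < 1 := by
        refine (real_inner_le_norm _ _).trans_lt ?_
        rw [hθ1, mul_one]; simpa [hB] using hx
      have e3 : r⁻¹ * inner ℝ v θ ≤ G θ / r := by
        rw [div_eq_inv_mul]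
        exact mul_le_mul_of_nonneg_left (hGV v hv θ) (inv_nonneg.2 hr.le)
      rw [e1, hz, inner_add_left, inner_smul_left, inner_smul_left, inner_smul_left]
      simp only [conj_trivial]
      nlinarith [mul_lt_mul_of_pos_left e2 (sub_pos.2 ht1), mul_le_mul_of_nonneg_left e3 ht.le])
  have hB0 : volume B ≠ 0 := (Metric.measure_ball_pos _ _ one_pos).ne'
  have hBt : volume B ≠ ⊤ := measure_ball_lt_top.ne
  rw [hK, ← ENNReal.rpow_add _ _ hB0 hBt, sub_add_cancel, ENNReal.rpow_one] at hbm
  refine hbm.trans (le_of_eq ?_)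
  exact measure_congr (insert_ae_eq_self _ _)

theorem second_step (n : ℕ) (hn : 0 < n)
    (G : EuclideanSpace ℝ (Fin n) → ℝ) (hG : Continuous G) (hG0 : ∀ x, 0 ≤ G x)
    {r : ℝ} (hr : 0 < r)
    (H : ∀ t : ℝ, 0 < t → t < 1 → volume (Metric.ball (0 : EuclideanSpace ℝ (Fin n)) 1) ≤
      ∫⁻ θ, ENNReal.ofReal ((1 + t * (G (θ : EuclideanSpace ℝ (Fin n)) / r - 1)) ^ n / n)
      ∂(volume : Measure (EuclideanSpace ℝ (Fin n))).toSphere) :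
    0 ≤ ∫ θ, (G (θ : EuclideanSpace ℝ (Fin n)) / r - 1)
      ∂(volume : Measure (EuclideanSpace ℝ (Fin n))).toSphere := by
  set σ := (volume : Measure (EuclideanSpace ℝ (Fin n))).toSphere with hσ
  set u : Metric.sphere (0 : EuclideanSpace ℝ (Fin n)) 1 → ℝ :=
    fun θ => G (θ : EuclideanSpace ℝ (Fin n)) / r - 1 with hu
  have hn' : (0 : ℝ) < n := by exact_mod_cast hn
  have huc : Continuous u := by fun_prop
  have : CompactSpace (Metric.sphere (0 : EuclideanSpace ℝ (Fin n)) 1) :=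
    isCompact_iff_compactSpace.1 (isCompact_sphere _ _)
  obtain ⟨M, hM⟩ := isCompact_univ.exists_bound_of_continuousOn huc.continuousOn
  have hui : Integrable u σ := Integrable.of_bound huc.aestronglyMeasurable M
    (Filter.Eventually.of_forall fun θ => hM θ trivial)
  set N := max M 1 with hN
  have hN1 : 1 ≤ N := le_max_right _ _
  have hMN : ∀ θ, |u θ| ≤ N := fun θ => (hM θ trivial).trans (le_max_left _ _)
  set b := (volume : Measure (EuclideanSpace ℝ (Fin n))).real (Metric.ball 0 1) with hb
  have hsu : σ.real Set.univ = n * b := by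
    rw [hσ, Measure.toSphere_real_apply_univ, finrank_euclideanSpace_fin]
  have key : ∀ t : ℝ, 0 < t → t < 1 → n * t * N ≤ 1 → 0 ≤ (n ^ 2 * N ^ 2 * b) * t + ∫ θ, u θ ∂σ := by
    intro t ht ht1 htN
    have hi : Integrable (fun θ => (1 + n * t * u θ + (n * t * N) ^ 2) / n) σ :=
      (((integrable_const _).add (hui.const_mul _)).add (integrable_const _)).div_const _
    have hle : ∀ θ, (1 + t * u θ) ^ n / n ≤ (1 + n * t * u θ + (n * t * N) ^ 2) / n := by
      intro θ
      refine div_le_div_of_nonneg_right ?_ hn'.le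
      have h0 : 0 ≤ 1 + t * u θ := by
        have : 0 ≤ t * (G θ / r) := mul_nonneg ht.le (div_nonneg (hG0 _) hr.le)
        simp only [hu]; nlinarith
      have h1 : (1 + t * u θ) ^ n ≤ Real.exp (n * t * u θ) := by
        rw [mul_assoc, Real.exp_nat_mul]
        exact pow_le_pow_left₀ h0 (by linarith [Real.add_one_le_exp (t * u θ)]) n
      have hx : |n * t * u θ| ≤ n * t * N := by
        rw [abs_mul, abs_of_pos (by positivity)]
        exact mul_le_mul_of_nonneg_left (hMN θ) (by positivity)
      have h2 := (abs_le.1 (Real.abs_exp_sub_one_sub_id_le (hx.trans htN))).2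
      have h3 : (n * t * u θ) ^ 2 ≤ (n * t * N) ^ 2 := sq_le_sq' (by linarith [(abs_le.1 hx).1]) (abs_le.1 hx).2
      linarith
    have hnn : ∀ θ, 0 ≤ (1 + n * t * u θ + (n * t * N) ^ 2) / n := by
      intro θ
      refine le_trans ?_ (hle θ)
      have h0 : 0 ≤ 1 + t * u θ := by
        have : 0 ≤ t * (G θ / r) := mul_nonneg ht.le (div_nonneg (hG0 _) hr.le)
        simp only [hu]; nlinarith
      positivity
    have h1 := (H t ht ht1).trans (lintegral_mono fun θ => ENNReal.ofReal_le_ofReal (hle θ))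
    rw [← ofReal_integral_eq_lintegral_ofReal hi (Filter.Eventually.of_forall hnn)] at h1
    have h2 : b ≤ ∫ θ, (1 + n * t * u θ + (n * t * N) ^ 2) / n ∂σ := by
      have := ENNReal.toReal_mono ENNReal.ofReal_ne_top h1
      rwa [ENNReal.toReal_ofReal (integral_nonneg hnn)] at this
    have h3 : ∫ θ, (1 + n * t * u θ + (n * t * N) ^ 2) / n ∂σ =
        (n * b * (1 + (n * t * N) ^ 2) + n * t * ∫ θ, u θ ∂σ) / n := by
      rw [integral_div, integral_add (f := fun θ => 1 + n * t * u θ) ((integrable_const _).add (hui.const_mul _))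
        (integrable_const _), integral_add (integrable_const _) (hui.const_mul _),
        integral_const_mul, integral_const, integral_const, hsu]
      simp only [smul_eq_mul]
      ring
    rw [h3, le_div_iff₀ hn'] at h2
    have h4 : 0 ≤ (n * t) * ((n ^ 2 * N ^ 2 * b) * t + ∫ θ, u θ ∂σ) := by nlinarith
    exact nonneg_of_mul_nonneg_right h4 (by positivity)
  have hlim : Filter.Tendsto (fun t : ℝ => (n ^ 2 * N ^ 2 * b) * t + ∫ θ, u θ ∂σ)
      (nhdsWithin 0 (Set.Ioi 0)) (nhds (∫ θ, u θ ∂σ)) := by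
    have : Continuous fun t : ℝ => (n ^ 2 * N ^ 2 * b) * t + ∫ θ, u θ ∂σ := by fun_prop
    simpa using (this.tendsto 0).mono_left nhdsWithin_le_nhds
  refine ge_of_tendsto hlim ?_
  have hd : (0 : ℝ) < min 1 (1 / (n * N)) := by positivity
  filter_upwards [Ioo_mem_nhdsGT hd] with t ht
  refine key t ht.1 (ht.2.trans_le (min_le_left _ _)) ?_
  have := ht.2.le.trans (min_le_right _ _)
  rw [le_div_iff₀ (by positivity)] at this
  linarith

/-- for a convex origin-symmetric body `V ⊆ ℝⁿ` with polar body
`V° = {y | ∀ x ∈ V, ⟪x,y⟫ ≤ 1}`, `Vol(V) ≤ E[‖·‖_{V°}]ⁿ · Vol(B₂ⁿ)`, where `‖·‖_{V°}`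
is the gauge of `V°` and the expectation is over the normalized uniform measure on the
unit sphere. -/
theorem volume_upper_bound_via_polar_expectation (n : ℕ) (hn : 0 < n)
    (V : Set (EuclideanSpace ℝ (Fin n)))
    (hVconv : Convex ℝ V) (hVsym : ∀ x ∈ V, -x ∈ V)
    (hV0 : (0 : EuclideanSpace ℝ (Fin n)) ∈ interior V) (hVcpt : IsCompact V)
    (P : Set (EuclideanSpace ℝ (Fin n)))
    (hP : P = {y | ∀ x ∈ V, inner (𝕜 := ℝ) x y ≤ 1})
    (μ : Measure ↥(Metric.sphere (0 : EuclideanSpace ℝ (Fin n)) 1))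
    (hμ : μ = ((volume : Measure (EuclideanSpace ℝ (Fin n))).toSphere Set.univ)⁻¹ •
        (volume : Measure (EuclideanSpace ℝ (Fin n))).toSphere) :
    volume V ≤
      ENNReal.ofReal ((∫ α, gauge P (α : EuclideanSpace ℝ (Fin n)) ∂μ) ^ n) *
        volume (Metric.closedBall (0 : EuclideanSpace ℝ (Fin n)) 1) := by
  have : Nonempty (Fin n) := ⟨⟨0, hn⟩⟩
  obtain ⟨R, hR0, hR⟩ := hVcpt.isBounded.exists_pos_norm_le
  have hPnhds : P ∈ nhds (0 : EuclideanSpace ℝ (Fin n)) := by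
    refine Filter.mem_of_superset (Metric.ball_mem_nhds 0 (inv_pos.2 hR0)) ?_
    intro y hy
    rw [hP]
    intro x hx
    have hy' : ‖y‖ ≤ R⁻¹ := by simpa using (mem_ball_zero_iff.1 hy).le
    calc inner ℝ x y ≤ ‖x‖ * ‖y‖ := real_inner_le_norm _ _
      _ ≤ R * R⁻¹ := mul_le_mul (hR x hx) hy' (norm_nonneg _) hR0.le
      _ = 1 := mul_inv_cancel₀ hR0.ne'
  have hPconv : Convex ℝ P := by
    rw [hP]
    intro y hy z hz a b ha hb hab x hx
    rw [inner_add_right, inner_smul_right, inner_smul_right]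
    nlinarith [mul_le_mul_of_nonneg_left (hy x hx) ha, mul_le_mul_of_nonneg_left (hz x hx) hb]
  have hG : Continuous (gauge P) := continuous_gauge hPconv hPnhds
  have hGV : ∀ x ∈ V, ∀ θ, inner ℝ x θ ≤ gauge P θ := by
    intro x hx θ
    rw [gauge_def']
    refine le_csInf ?_ ?_
    · have := (absorbent_nhds_zero hPnhds).gauge_set_nonempty (x := θ)
      obtain ⟨c, hc, hc'⟩ := this
      exact ⟨c, hc, (Set.mem_smul_set_iff_inv_smul_mem₀ (ne_of_gt hc) _ _).1 hc'⟩
    · rintro c ⟨hc, hc'⟩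
      have hc : 0 < c := hc
      rw [hP] at hc'
      have := hc' x hx
      rw [inner_smul_right, inv_mul_le_iff₀ hc, mul_one] at this
      exact this
  set σ := (volume : Measure (EuclideanSpace ℝ (Fin n))).toSphere with hσ
  have hn' : (0 : ℝ) < n := by exact_mod_cast hn
  have hb0 : volume (Metric.ball (0 : EuclideanSpace ℝ (Fin n)) 1) ≠ 0 :=
    (Metric.measure_ball_pos _ _ one_pos).ne'
  have hbt : volume (Metric.ball (0 : EuclideanSpace ℝ (Fin n)) 1) ≠ ⊤ := measure_ball_lt_top.ne
  have hV0' : volume V ≠ 0 := (Measure.measure_pos_of_mem_nhds _ (mem_interior_iff_mem_nhds.1 hV0)).ne'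
  have hVt : volume V ≠ ⊤ := hVcpt.measure_lt_top.ne
  set q : ℝ := (volume V).toReal / (volume (Metric.ball (0 : EuclideanSpace ℝ (Fin n)) 1)).toReal
    with hq
  have hq0 : 0 < q := div_pos (ENNReal.toReal_pos hV0' hVt) (ENNReal.toReal_pos hb0 hbt)
  set r : ℝ := q ^ ((n : ℝ)⁻¹) with hrdef
  have hr : 0 < r := Real.rpow_pos_of_pos hq0 _
  have hrn : r ^ n = q := Real.rpow_inv_natCast_pow hq0.le hn.ne'
  have hvol : volume V = ENNReal.ofReal (r ^ n) *
      volume (Metric.ball (0 : EuclideanSpace ℝ (Fin n)) 1) := by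
    rw [hrn, hq, ENNReal.ofReal_div_of_pos (ENNReal.toReal_pos hb0 hbt), ENNReal.ofReal_toReal hVt,
      ENNReal.ofReal_toReal hbt, ENNReal.div_mul_cancel hb0 hbt]
  have h2 := second_step n hn (gauge P) hG gauge_nonneg hr
    (fun t ht ht1 => first_step n hn V hVcpt (gauge P) hG gauge_nonneg hGV hr hvol ht ht1)
  rw [← hσ] at h2
  have : CompactSpace (Metric.sphere (0 : EuclideanSpace ℝ (Fin n)) 1) :=
    isCompact_iff_compactSpace.1 (isCompact_sphere _ _)
  have hgc : Continuous fun θ : Metric.sphere (0 : EuclideanSpace ℝ (Fin n)) 1 =>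
    gauge P (θ : EuclideanSpace ℝ (Fin n)) := by fun_prop
  obtain ⟨M, hM⟩ := isCompact_univ.exists_bound_of_continuousOn hgc.continuousOn
  have hgi : Integrable (fun θ : Metric.sphere (0 : EuclideanSpace ℝ (Fin n)) 1 =>
    gauge P (θ : EuclideanSpace ℝ (Fin n))) σ := Integrable.of_bound hgc.aestronglyMeasurable M
    (Filter.Eventually.of_forall fun θ => hM θ trivial)
  rw [integral_sub (hgi.div_const _) (integrable_const _), integral_div, integral_const,
    smul_eq_mul, mul_one, sub_nonneg, le_div_iff₀ hr] at h2
  have hs0 : 0 < σ.real Set.univ := by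
    rw [hσ, Measure.toSphere_real_apply_univ, finrank_euclideanSpace_fin]
    exact mul_pos hn' (ENNReal.toReal_pos hb0 hbt)
  have hfin : r ≤ ∫ α, gauge P (α : EuclideanSpace ℝ (Fin n)) ∂μ := by
    rw [hμ, integral_smul_measure, ENNReal.toReal_inv, smul_eq_mul]
    change r ≤ (σ.real Set.univ)⁻¹ * _
    rw [le_inv_mul_iff₀ hs0]
    exact h2
  rw [hvol, Measure.addHaar_closedBall_eq_addHaar_ball]
  gcongr
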